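/- arXiv:2106.14836 — 2 statements merged into one kernel-verified Lean document; each statement's English description precedes it below -/
import Mathlib

section
/- Suppose σ̃ is real analytic on ℝ and, for each i ∈ {1,...,n}, the map u ↦ z(x_i,u) is real analytic on ℝ^{d'}. Suppose the safe-exploration condition holds: there exist q ∈ ℝ^{m_{H-1}×m_H} and u ∈ ℝ^{d'} with rank(φ(q,u)) = n. Fix a positive integer m_y, set D = d' + m_y·m_H·m_{H-1} + m_y·m_H, and identify a vector v ∈ ℝ^D with a tuple (u, (R^{(1)},...,R^{(m_y)}), (w^{(1)},...,w^{(m_y)})) where u ∈ ℝ^{d'}, R^{(j)} ∈ ℝ^{m_{H-1}×m_H} and w^{(j)} ∈ ℝ^{m_H}. Fix v̄ ∈ ℝ^D and ε > 0, and let δ be a random vector in ℝ^D with independent standard normal coordinates. Then with probability one, the vector v = v̄ + ε·δ satisfies rank(φ(R^{(j)}, u)·(diag(w^{(j)}) ⊗ I_{m_{H-1}})) = n for every j ∈ {1,...,m_y}. (Lemma 5 of the appendix, lemma:4.) -/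
open scoped Kronecker

section AnalyticZeroSet

open MeasureTheory

/-- Analyticity is preserved when a function of finitely many real variables is restricted to a
coordinate line. -/
theorem AnalyticOnNhd.comp_update {ι : Type*} [Fintype ι] [DecidableEq ι] {f : (ι → ℝ) → ℝ}
    (hf : AnalyticOnNhd ℝ f Set.univ) (a : ι → ℝ) (i : ι) :
    AnalyticOnNhd ℝ (fun t => f (Function.update a i t)) Set.univ := by
  refine hf.comp (AnalyticOnNhd.pi fun k => ?_) (Set.mapsTo_univ _ _)
  rcases eq_or_ne k i with rfl | hk
  · simpa using analyticOnNhd_id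
  · simpa [Function.update_of_ne hk] using analyticOnNhd_const

/-- A real analytic function of one variable that is not identically zero is nonzero almost
everywhere with respect to any atomless measure. -/
theorem AnalyticOnNhd.ae_ne_zero_real {f : ℝ → ℝ} (hf : AnalyticOnNhd ℝ f Set.univ) {a : ℝ}
    (ha : f a ≠ 0) (μ : Measure ℝ) [NullSingletonClass μ] : ∀ᵐ t ∂μ, f t ≠ 0 := by
  have h := ae_restrict_le_codiscreteWithin (μ := μ) MeasurableSet.univ
    (hf.preimage_zero_mem_codiscrete ha)
  rwa [Measure.restrict_univ] at h

/-- A real analytic function of finitely many variables that is not identically zero is nonzero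
almost everywhere with respect to any product of atomless measures. -/
theorem AnalyticOnNhd.ae_ne_zero_pi {ι : Type*} [Fintype ι] {f : (ι → ℝ) → ℝ}
    (hf : AnalyticOnNhd ℝ f Set.univ) {a : ι → ℝ} (ha : f a ≠ 0) (μ : ι → Measure ℝ)
    [∀ i, SigmaFinite (μ i)] [∀ i, NullSingletonClass (μ i)] :
    ∀ᵐ ω ∂Measure.pi μ, f ω ≠ 0 := by
  classical
  have hcont : Continuous f := continuousOn_univ.1 hf.continuousOn
  have hmeas : MeasurableSet {ω | f ω = 0} := (isClosed_singleton.preimage hcont).measurableSet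
  set F : (ι → ℝ) → ENNReal := {ω | f ω = 0}.indicator 1
  have hF : Measurable F := measurable_one.indicator hmeas
  have key : ∀ (s : Finset ι) (b : ι → ℝ), f b ≠ 0 → (∫⋯∫⁻_s, F ∂μ) b = 0 := by
    intro s
    induction s using Finset.induction_on with
    | empty => intro b hb; simp [F, hb]
    | insert i s hi ih =>
      intro b hb
      rw [lmarginal_insert F hF hi]
      refine lintegral_eq_zero_of_ae_eq_zero ?_
      have hline := (hf.comp_update b i).ae_ne_zero_real (a := b i) (by simpa using hb) (μ i)
      filter_upwards [hline] with t ht using ih _ ht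
  have h0 := key Finset.univ a ha
  rw [← lintegral_eq_lmarginal_univ, lintegral_indicator_one hmeas] at h0
  simpa [ae_iff] using h0

end AnalyticZeroSet

/-- A square matrix over a field has full rank exactly when its determinant is nonzero. -/
theorem Matrix.rank_eq_card_iff_det_ne_zero {m K : Type*} [Fintype m] [DecidableEq m] [Field K]
    {A : Matrix m m K} : A.rank = Fintype.card m ↔ A.det ≠ 0 := by
  refine ⟨fun h => ?_, Matrix.rank_of_det_ne_zero⟩
  rw [← isUnit_iff_ne_zero, ← Matrix.isUnit_iff_isUnit_det, ← Matrix.mulVec_surjective_iff_isUnit]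
  exact LinearMap.range_eq_top.1 (Submodule.eq_top_of_finrank_eq (S := LinearMap.range A.mulVecLin)
    (by rw [Module.finrank_fintype_fun_eq_card]; exact h))

/-- A real matrix has full row rank exactly when its Gram determinant is nonzero. -/
theorem Matrix.rank_eq_card_iff_det_mul_transpose_ne_zero {m k : Type*} [Fintype m] [DecidableEq m]
    [Fintype k] {A : Matrix m k ℝ} :
    A.rank = Fintype.card m ↔ (A * A.transpose).det ≠ 0 := by
  rw [← Matrix.rank_eq_card_iff_det_ne_zero, Matrix.rank_self_mul_transpose]

section AnalyticMatrix

variable {E m k l : Type*} [NormedAddCommGroup E] [NormedSpace ℝ E]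

theorem Matrix.analyticOnNhd_mul_apply [Fintype k] {A : E → Matrix m k ℝ} {B : E → Matrix k l ℝ}
    {s : Set E} (hA : ∀ i j, AnalyticOnNhd ℝ (fun ω => A ω i j) s)
    (hB : ∀ i j, AnalyticOnNhd ℝ (fun ω => B ω i j) s) (i : m) (j : l) :
    AnalyticOnNhd ℝ (fun ω => (A ω * B ω) i j) s := by
  simp only [Matrix.mul_apply]
  exact Finset.analyticOnNhd_fun_sum _ fun c _ => (hA i c).mul (hB c j)

theorem Matrix.analyticOnNhd_det [Fintype m] [DecidableEq m] {A : E → Matrix m m ℝ} {s : Set E}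
    (hA : ∀ i j, AnalyticOnNhd ℝ (fun ω => A ω i j) s) :
    AnalyticOnNhd ℝ (fun ω => (A ω).det) s := by
  simp only [Matrix.det_apply']
  exact Finset.analyticOnNhd_fun_sum _ fun p _ =>
    analyticOnNhd_const.mul (Finset.analyticOnNhd_fun_prod _ fun i _ => hA _ _)

end AnalyticMatrix

/-- A matrix depending analytically on finitely many real parameters, of full row rank for at
least one parameter, has full row rank for almost every parameter with respect to any product of
atomless measures. -/
theorem Matrix.ae_rank_eq_card_of_analyticOnNhd {ι m k : Type*} [Fintype ι] [Fintype m] [Fintype k]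
    {A : (ι → ℝ) → Matrix m k ℝ}
    (hA : ∀ i j, AnalyticOnNhd ℝ (fun ω => A ω i j) Set.univ) {a : ι → ℝ}
    (ha : (A a).rank = Fintype.card m) (μ : ι → MeasureTheory.Measure ℝ)
    [∀ i, MeasureTheory.SigmaFinite (μ i)] [∀ i, MeasureTheory.NullSingletonClass (μ i)] :
    ∀ᵐ ω ∂MeasureTheory.Measure.pi μ, (A ω).rank = Fintype.card m := by
  classical
  simp only [Matrix.rank_eq_card_iff_det_mul_transpose_ne_zero] at ha ⊢
  exact (Matrix.analyticOnNhd_det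
    (Matrix.analyticOnNhd_mul_apply hA fun i j => hA j i)).ae_ne_zero_pi ha μ

/-- Lemma 5 of the appendix (`lemma:4`): under real analyticity and the safe-exploration
condition, a Gaussian perturbation `v = v̄ + ε δ` (with `δ` having independent standard normal
coordinates, encoded by the product measure `⨂ gaussianReal 0 1` over the coordinate index set
`Fin d' ⊕ (Fin m_y × Fin m_{H-1} × Fin m_H) ⊕ (Fin m_y × Fin m_H)`) almost surely yields
`rank(φ(R⁽ʲ⁾, u) (diag(w⁽ʲ⁾) ⊗ I)) = n` for every `j`. -/
theorem stmt_10
    (n mx mH mH1 d' my : ℕ) (hn : 0 < n) (hmH : 0 < mH) (hmH1 : 0 < mH1) (hmy : 0 < my)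
    (x : Fin n → Fin mx → ℝ)
    (z : (Fin mx → ℝ) → (Fin d' → ℝ) → (Fin mH1 → ℝ))
    (σt : ℝ → ℝ)
    (φ : (Fin mH1 → Fin mH → ℝ) → (Fin d' → ℝ) → Matrix (Fin n) (Fin mH × Fin mH1) ℝ)
    (hφ : ∀ q u i kl, φ q u i kl = σt (∑ l, z (x i) u l * q l kl.1) * z (x i) u kl.2)
    (hσ : AnalyticOnNhd ℝ σt Set.univ)
    (hz : ∀ i, AnalyticOnNhd ℝ (z (x i)) Set.univ)
    -- safe-exploration condition
    (hsafe : ∃ q u, (φ q u).rank = n)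
    (ubar : Fin d' → ℝ)
    (Rbar : Fin my → Fin mH1 → Fin mH → ℝ)
    (wbar : Fin my → Fin mH → ℝ)
    (ε : ℝ) (hε : 0 < ε) :
    (MeasureTheory.Measure.pi
        (fun _ : (Fin d') ⊕ ((Fin my × Fin mH1 × Fin mH) ⊕ (Fin my × Fin mH)) =>
          ProbabilityTheory.gaussianReal 0 1))
      {ω | ∀ j : Fin my,
        (φ (fun l k => Rbar j l k + ε * ω (Sum.inr (Sum.inl (j, l, k))))
              (fun s => ubar s + ε * ω (Sum.inl s)) *
            (Matrix.diagonal (fun k => wbar j k + ε * ω (Sum.inr (Sum.inr (j, k)))) ⊗ₖ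
              (1 : Matrix (Fin mH1) (Fin mH1) ℝ))).rank = n} = 1 := by
  have hatom : MeasureTheory.NullSingletonClass (ProbabilityTheory.gaussianReal 0 1) :=
    ProbabilityTheory.nullSingletonClass_gaussianReal one_ne_zero
  suffices h : ∀ᵐ ω ∂MeasureTheory.Measure.pi
        (fun _ : (Fin d') ⊕ ((Fin my × Fin mH1 × Fin mH) ⊕ (Fin my × Fin mH)) =>
          ProbabilityTheory.gaussianReal 0 1), ∀ j : Fin my,
        (φ (fun l k => Rbar j l k + ε * ω (Sum.inr (Sum.inl (j, l, k))))
              (fun s => ubar s + ε * ω (Sum.inl s)) *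
            (Matrix.diagonal (fun k => wbar j k + ε * ω (Sum.inr (Sum.inr (j, k)))) ⊗ₖ
              (1 : Matrix (Fin mH1) (Fin mH1) ℝ))).rank = n by
    rw [MeasureTheory.measure_congr (Filter.eventuallyEq_univ.2 h), MeasureTheory.measure_univ]
  refine MeasureTheory.ae_all_iff.2 fun j => ?_
  obtain ⟨q, u, hqu⟩ := hsafe
  have hcoord : ∀ (c : ℝ) (i : (Fin d') ⊕ ((Fin my × Fin mH1 × Fin mH) ⊕ (Fin my × Fin mH))),
      AnalyticOnNhd ℝ (fun ω : _ → ℝ => c + ε * ω i) Set.univ := fun c i =>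
    analyticOnNhd_const.add (analyticOnNhd_const.mul
      ((ContinuousLinearMap.proj (R := ℝ) (φ := fun _ => ℝ) i).analyticOnNhd _))
  have hcancel : ∀ c t : ℝ, c + ε * ((t - c) / ε) = t := fun c t => by
    rw [mul_div_cancel₀ _ hε.ne', add_sub_cancel]
  have hzu : ∀ i l, AnalyticOnNhd ℝ
      (fun ω : (Fin d') ⊕ ((Fin my × Fin mH1 × Fin mH) ⊕ (Fin my × Fin mH)) → ℝ =>
        z (x i) (fun s => ubar s + ε * ω (Sum.inl s)) l) Set.univ := fun i l =>
    (analyticOnNhd_pi_iff.1 (hz i) l).comp (AnalyticOnNhd.pi fun s => hcoord _ _)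
      (Set.mapsTo_univ _ _)
  have hdiag : ∀ a b, AnalyticOnNhd ℝ
      (fun ω : (Fin d') ⊕ ((Fin my × Fin mH1 × Fin mH) ⊕ (Fin my × Fin mH)) → ℝ =>
        (Matrix.diagonal (fun k => wbar j k + ε * ω (Sum.inr (Sum.inr (j, k)))) ⊗ₖ
          (1 : Matrix (Fin mH1) (Fin mH1) ℝ)) a b) Set.univ := fun ⟨a, b⟩ ⟨c, d⟩ => by
    simp only [Matrix.kroneckerMap_apply, Matrix.diagonal_apply]
    refine AnalyticOnNhd.mul ?_ analyticOnNhd_const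
    split_ifs
    · exact hcoord _ _
    · exact analyticOnNhd_const
  have hfull := Matrix.ae_rank_eq_card_of_analyticOnNhd
    (A := fun ω => φ (fun l k => Rbar j l k + ε * ω (Sum.inr (Sum.inl (j, l, k))))
              (fun s => ubar s + ε * ω (Sum.inl s)) *
            (Matrix.diagonal (fun k => wbar j k + ε * ω (Sum.inr (Sum.inr (j, k)))) ⊗ₖ
              (1 : Matrix (Fin mH1) (Fin mH1) ℝ)))
    (a := Sum.elim (fun s => (u s - ubar s) / ε)
      (Sum.elim (fun p => (q p.2.1 p.2.2 - Rbar p.1 p.2.1 p.2.2) / ε)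
        (fun p => (1 - wbar p.1 p.2) / ε)))
    (Matrix.analyticOnNhd_mul_apply (fun i kl => ?_) hdiag) ?_
    (fun _ => ProbabilityTheory.gaussianReal 0 1)
  · simpa using hfull
  · simp only [hφ]
    refine AnalyticOnNhd.mul (hσ.comp ?_ (Set.mapsTo_univ _ _)) (hzu i _)
    exact Finset.analyticOnNhd_fun_sum _ fun l _ => (hzu i l).mul (hcoord _ _)
  · simpa [hcancel] using hqu
end

section
/- Assume each ℓ_i is differentiable, convex, and has L_ℓ-Lipschitz gradient with L_ℓ ≥ 0; the rank condition holds; and L̂_c = (L_ℓ/n)·Σ_{i=1}^n Z_i² > 0, where Z_i = max_j ‖(diag(a^{(j)}) ⊗ I_{m_{H-1}})·(φ(R^{(j)},u)_{i*})ᵀ‖. Let τ ∈ ℕ and define W^{t+1} = W^t − (1/L̂_c)·∇L̂(W^t) for t ≥ τ from an initial point W^τ. Fix ε̄ ≥ 0, suppose the set Θ_ε̄ = {W : max(L̂(W), ε̄) ≤ max(L̂(W'), ε̄) for all W'} is nonempty, and set B_ε̄ = inf{‖W − W^τ‖ : W ∈ Θ_ε̄}. Then for every t > τ and every q_1,...,q_n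 ∈ ℝ^{m_y}: L̂(W^t) ≤ max((1/n) Σ_{i=1}^n ℓ_i(q_i), ε̄) + L̂_c·B_ε̄² / (2(t−τ)). (Deterministic core of Theorem 6(i), on the probability-one event established by the appendix Lemma lemma:4.) -/
open scoped Kronecker Matrix
open scoped InnerProductSpace

section FirstOrder

variable {E : Type*} [NormedAddCommGroup E] [InnerProductSpace ℝ E] [CompleteSpace E]

theorem Differentiable.hasDerivAt_comp_lineMap {f : E → ℝ} (hf : Differentiable ℝ f) (x y : E)
    (t : ℝ) :
    HasDerivAt (fun s : ℝ => f (AffineMap.lineMap x y s))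
      ⟪gradient f (AffineMap.lineMap x y t), y - x⟫_ℝ t := by
  rw [inner_gradient_left]
  exact (hf _).hasFDerivAt.comp_hasDerivAt t AffineMap.hasDerivAt_lineMap

theorem ConvexOn.add_inner_gradient_le {f : E → ℝ} (hconv : ConvexOn ℝ Set.univ f)
    (hf : Differentiable ℝ f) (x y : E) : f x + ⟪gradient f x, y - x⟫_ℝ ≤ f y := by
  have hg : ConvexOn ℝ Set.univ (fun s : ℝ => f (AffineMap.lineMap x y s)) :=
    hconv.comp_affineMap (AffineMap.lineMap x y : ℝ →ᵃ[ℝ] E)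
  have h := hg.le_slope_of_hasDerivAt (Set.mem_univ 0) (Set.mem_univ 1) one_pos
    (hf.hasDerivAt_comp_lineMap x y 0)
  simp only [slope_def_field, AffineMap.lineMap_apply_zero, AffineMap.lineMap_apply_one] at h
  linarith

theorem le_add_inner_gradient_of_lipschitz {f : E → ℝ} {L : ℝ} (hf : Differentiable ℝ f)
    (hlip : ∀ p q, ‖gradient f p - gradient f q‖ ≤ L * ‖p - q‖) (x y : E) :
    f y ≤ f x + ⟪gradient f x, y - x⟫_ℝ + L / 2 * ‖y - x‖ ^ 2 := by
  let g : ℝ → ℝ := fun s => f (AffineMap.lineMap x y s) -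
    (s * ⟪gradient f x, y - x⟫_ℝ + L / 2 * ‖y - x‖ ^ 2 * s ^ 2)
  have hg (t : ℝ) : HasDerivAt g (⟪gradient f (AffineMap.lineMap x y t), y - x⟫_ℝ -
      (1 * ⟪gradient f x, y - x⟫_ℝ + L / 2 * ‖y - x‖ ^ 2 * (2 * t))) t := by
    refine (hf.hasDerivAt_comp_lineMap x y t).sub
      (((hasDerivAt_id t).mul_const _).add (HasDerivAt.const_mul _ ?_))
    simpa using hasDerivAt_pow 2 t
  have hanti : AntitoneOn g (Set.Icc 0 1) := by
    refine antitoneOn_of_deriv_nonpos (convex_Icc 0 1)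
      (fun t _ => (hg t).continuousAt.continuousWithinAt)
      (fun t _ => (hg t).differentiableAt.differentiableWithinAt) fun t ht => ?_
    rw [interior_Icc] at ht
    have hdist : ‖AffineMap.lineMap x y t - x‖ = t * ‖y - x‖ := by
      rw [AffineMap.lineMap_apply, vsub_eq_sub, vadd_eq_add, add_sub_cancel_right, norm_smul,
        Real.norm_of_nonneg ht.1.le]
    have hle := (real_inner_le_norm (gradient f (AffineMap.lineMap x y t) - gradient f x)
      (y - x)).trans (mul_le_mul_of_nonneg_right (hlip _ _) (norm_nonneg _))
    rw [hdist, inner_sub_left] at hle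
    rw [(hg t).deriv]
    linarith
  have h := hanti (Set.left_mem_Icc.2 zero_le_one) (Set.right_mem_Icc.2 zero_le_one) zero_le_one
  simp only [g, AffineMap.lineMap_apply_zero, AffineMap.lineMap_apply_one] at h
  linarith

/-- The convergence rate of gradient descent with step size `1 / L` on a differentiable convex
function satisfying the quadratic upper bound with constant `L`. -/
theorem gradientDescent_le {f : E → ℝ} {L : ℝ} (hL : 0 < L) (hf : Differentiable ℝ f)
    (hconv : ConvexOn ℝ Set.univ f)
    (hsmooth : ∀ x y, f y ≤ f x + ⟪gradient f x, y - x⟫_ℝ + L / 2 * ‖y - x‖ ^ 2)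
    {w : ℕ → E} (hw : ∀ k, w (k + 1) = w k - (1 / L) • gradient f (w k)) (v : E) (k : ℕ) :
    k * (f (w k) - f v) ≤ L / 2 * (‖w 0 - v‖ ^ 2 - ‖w k - v‖ ^ 2) := by
  induction k with
  | zero => simp
  | succ k ih =>
    set G := gradient f (w k) with hG
    have hdesc : f (w (k + 1)) ≤ f (w k) - 1 / (2 * L) * ‖G‖ ^ 2 := by
      have h := hsmooth (w k) (w (k + 1))
      have hdiff : w (k + 1) - w k = -((1 / L) • G) := by rw [hw]; abel
      rw [hdiff, ← hG, inner_neg_right, real_inner_smul_right, real_inner_self_eq_norm_sq,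
        norm_neg, norm_smul, Real.norm_of_nonneg (by positivity)] at h
      refine h.trans_eq ?_
      field_simp
      ring
    have hmono : f (w (k + 1)) ≤ f (w k) :=
      hdesc.trans (sub_le_self _ (by positivity))
    have hfirst := hconv.add_inner_gradient_le hf (w k) v
    have hnorm : L / 2 * ‖w (k + 1) - v‖ ^ 2 =
        L / 2 * ‖w k - v‖ ^ 2 - ⟪G, w k - v⟫_ℝ + 1 / (2 * L) * ‖G‖ ^ 2 := by
      have hdiff : w (k + 1) - v = (w k - v) - (1 / L) • G := by rw [hw]; abel
      rw [hdiff, norm_sub_sq_real, real_inner_smul_right, norm_smul,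
        Real.norm_of_nonneg (by positivity), real_inner_comm]
      field_simp
    rw [← neg_sub (w k) v, inner_neg_right] at hfirst
    have hk := mul_le_mul_of_nonneg_left hmono (Nat.cast_nonneg (α := ℝ) k)
    push_cast
    linarith

end FirstOrder

theorem le_mul_sInf_sq {S : Set ℝ} (hS : S.Nonempty) (hnn : ∀ d ∈ S, 0 ≤ d) {c K : ℝ}
    (hK : 0 < K) (h : ∀ d ∈ S, c ≤ K * d ^ 2) : c ≤ K * sInf S ^ 2 := by
  have hle : √(c / K) ≤ sInf S := le_csInf hS fun d hd =>
    Real.sqrt_le_iff.2 ⟨hnn d hd, by rw [div_le_iff₀' hK]; exact h d hd⟩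
  exact (div_le_iff₀' hK).1 (Real.sqrt_le_iff.1 hle).2

theorem Matrix.mulVec_surjective_of_rank_eq_card {m n K : Type*} [Fintype m] [Fintype n]
    [Field K] {A : Matrix m n K} (hA : A.rank = Fintype.card m) :
    Function.Surjective A.mulVec := by
  have h : A.mulVecLin.range = ⊤ :=
    Submodule.eq_top_of_finrank_eq (hA.trans (Module.finrank_fintype_fun_eq_card K).symm)
  exact LinearMap.range_eq_top.1 h

section FiniteSum

variable {ι E G : Type*} [Fintype ι] [NormedAddCommGroup E] [InnerProductSpace ℝ E]
  [NormedAddCommGroup G] [InnerProductSpace ℝ G]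
  {ℓ : ι → G → ℝ} {A : ι → E →L[ℝ] G} {f : E → ℝ} {c : ℝ}

theorem hasFDerivAt_mul_sum_comp (hℓ : ∀ i, Differentiable ℝ (ℓ i))
    (hf : ∀ w, f w = c * ∑ i, ℓ i (A i w)) (w : E) :
    HasFDerivAt f (c • ∑ i, (fderiv ℝ (ℓ i) (A i w)).comp (A i)) w := by
  rw [funext hf]
  exact (HasFDerivAt.fun_sum fun i _ =>
    (hℓ i _).hasFDerivAt.comp w (A i).hasFDerivAt).const_mul c

theorem convexOn_mul_sum_comp (hc : 0 ≤ c) (hℓ : ∀ i, ConvexOn ℝ Set.univ (ℓ i))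
    (hf : ∀ w, f w = c * ∑ i, ℓ i (A i w)) : ConvexOn ℝ Set.univ f := by
  refine ⟨convex_univ, fun x _ y _ a b ha hb hab => ?_⟩
  have h := Finset.sum_le_sum fun i (_ : i ∈ Finset.univ) =>
    (hℓ i).2 (Set.mem_univ (A i x)) (Set.mem_univ (A i y)) ha hb hab
  simp only [smul_eq_mul, Finset.sum_add_distrib, ← Finset.mul_sum] at h
  have h' := mul_le_mul_of_nonneg_left h hc
  simp only [hf, map_add, map_smul, smul_eq_mul]
  linarith

theorem mul_sum_comp_le_add_inner_gradient [CompleteSpace E] [CompleteSpace G] (hc : 0 ≤ c)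
    {L : ℝ} (hL : 0 ≤ L) (hℓ : ∀ i, Differentiable ℝ (ℓ i))
    (hlip : ∀ i p q, ‖gradient (ℓ i) p - gradient (ℓ i) q‖ ≤ L * ‖p - q‖)
    {Z : ι → ℝ} (hA : ∀ i w, ‖A i w‖ ^ 2 ≤ Z i ^ 2 * ‖w‖ ^ 2)
    (hf : ∀ w, f w = c * ∑ i, ℓ i (A i w)) (x y : E) :
    f y ≤ f x + ⟪gradient f x, y - x⟫_ℝ + (L * c * ∑ i, Z i ^ 2) / 2 * ‖y - x‖ ^ 2 := by
  have h := Finset.sum_le_sum fun i (_ : i ∈ Finset.univ) =>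
    (le_add_inner_gradient_of_lipschitz (hℓ i) (hlip i) (A i x) (A i y)).trans
      (add_le_add_right (mul_le_mul_of_nonneg_left
        ((map_sub (A i) y x) ▸ hA i (y - x)) (div_nonneg hL zero_le_two)) _)
  simp only [Finset.sum_add_distrib, ← Finset.mul_sum, ← Finset.sum_mul, ← map_sub,
    inner_gradient_left] at h
  have h' := mul_le_mul_of_nonneg_left h hc
  rw [inner_gradient_left, (hasFDerivAt_mul_sum_comp hℓ hf x).fderiv, hf, hf]
  simp only [smul_apply, sum_apply,
    ContinuousLinearMap.comp_apply, smul_eq_mul]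
  linarith

end FiniteSum

/-- Deterministic core of Theorem 6(i) (on the probability-one event of appendix Lemma
`lemma:4`): gradient descent with stepsize `1/L̂_c` on the convex objective `L̂` satisfies, for
every `t > τ` and every `q_1,…,q_n`,
`L̂(W^t) ≤ max((1/n) Σ_i ℓ_i(q_i), εbar) + L̂_c B_εbar² / (2(t−τ))`. -/
theorem stmt_16
    (n mx mH mH1 d' my : ℕ) (hn : 0 < n) (hmy : 0 < my)
    (x : Fin n → Fin mx → ℝ)
    (z : (Fin mx → ℝ) → (Fin d' → ℝ) → (Fin mH1 → ℝ))
    (σt : ℝ → ℝ)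
    (φ : (Fin mH1 → Fin mH → ℝ) → (Fin d' → ℝ) → Matrix (Fin n) (Fin mH × Fin mH1) ℝ)
    (hφ : ∀ q u i kl, φ q u i kl = σt (∑ l, z (x i) u l * q l kl.1) * z (x i) u kl.2)
    (u : Fin d' → ℝ)
    (R : Fin my → Fin mH1 → Fin mH → ℝ)
    (a : Fin my → Fin mH → ℝ)
    (ℓ : Fin n → EuclideanSpace ℝ (Fin my) → ℝ)
    (hℓnn : ∀ i p, 0 ≤ ℓ i p)
    (Lℓ : ℝ) (hLℓ : 0 ≤ Lℓ)
    (hℓdiff : ∀ i, Differentiable ℝ (ℓ i))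
    (hℓconv : ∀ i, ConvexOn ℝ Set.univ (ℓ i))
    (hℓlip : ∀ i p q, ‖gradient (ℓ i) p - gradient (ℓ i) q‖ ≤ Lℓ * ‖p - q‖)
    (F : EuclideanSpace ℝ (Fin my × Fin mH × Fin mH1) → Fin n → EuclideanSpace ℝ (Fin my))
    (hF : ∀ W i j, F W i j =
      ∑ k, a j k * σt (∑ l, z (x i) u l * R j l k) * (∑ l, W (j, k, l) * z (x i) u l))
    (Lhat : EuclideanSpace ℝ (Fin my × Fin mH × Fin mH1) → ℝ)
    (hLhat : ∀ W, Lhat W = (1 / (n : ℝ)) * ∑ i, ℓ i (F W i))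
    -- the rank condition
    (hrank : ∀ j, (φ (R j) u *
      (Matrix.diagonal (a j) ⊗ₖ (1 : Matrix (Fin mH1) (Fin mH1) ℝ))).rank = n)
    -- the Lipschitz constant L̂_c is positive
    (Z : Fin n → ℝ)
    (hZ : ∀ i, Z i = ⨆ j : Fin my,
      Real.sqrt (∑ c, (((Matrix.diagonal (a j) ⊗ₖ (1 : Matrix (Fin mH1) (Fin mH1) ℝ)).mulVec
        (fun c' => φ (R j) u i c')) c) ^ 2))
    (Lc : ℝ) (hLcdef : Lc = (Lℓ / (n : ℝ)) * ∑ i, Z i ^ 2) (hLc : 0 < Lc)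
    -- gradient descent from W^τ with stepsize 1/L̂_c
    (τ : ℕ)
    (W : ℕ → EuclideanSpace ℝ (Fin my × Fin mH × Fin mH1))
    (hupd : ∀ t, τ ≤ t → W (t + 1) = W t - (1 / Lc) • gradient Lhat (W t))
    -- the target set Θ_εbar and the distance B_εbar
    (εbar : ℝ) (hεbar : 0 ≤ εbar)
    (Θ : Set (EuclideanSpace ℝ (Fin my × Fin mH × Fin mH1)))
    (hΘ : Θ = {W' | ∀ W'', max (Lhat W') εbar ≤ max (Lhat W'') εbar})
    (hΘne : Θ.Nonempty)
    (B : ℝ) (hB : B = sInf ((fun W' => ‖W' - W τ‖) '' Θ)) :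
    ∀ t, τ < t → ∀ q : Fin n → EuclideanSpace ℝ (Fin my),
      Lhat (W t) ≤ max ((1 / (n : ℝ)) * ∑ i, ℓ i (q i)) εbar +
        Lc * B ^ 2 / (2 * ((t : ℝ) - (τ : ℝ))) := by
  have hentry (j i k l) : (φ (R j) u * (Matrix.diagonal (a j) ⊗ₖ
      (1 : Matrix (Fin mH1) (Fin mH1) ℝ))) i (k, l) = φ (R j) u i (k, l) * a j k := by
    rw [← Matrix.diagonal_one, Matrix.diagonal_kronecker_diagonal, Matrix.mul_diagonal, mul_one]
  have hFφ (V i j) : F V i j = ∑ kl : Fin mH × Fin mH1,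
      (a j kl.1 * φ (R j) u i kl) * V (j, kl) := by
    rw [hF, Fintype.sum_prod_type]
    refine Finset.sum_congr rfl fun k _ => ?_
    rw [Finset.mul_sum]
    refine Finset.sum_congr rfl fun l _ => ?_
    rw [hφ]
    ring
  have hlin (i) : IsLinearMap ℝ fun V => F V i := by
    constructor
    · intro V V'
      ext j
      simp only [PiLp.add_apply, hFφ, mul_add, Finset.sum_add_distrib]
    · intro r V
      ext j
      simp only [PiLp.smul_apply, hFφ, smul_eq_mul, Finset.mul_sum]
      exact Finset.sum_congr rfl fun kl _ => by ring
  let A (i) := LinearMap.toContinuousLinearMap (hlin i).mk'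
  have hfA (V) : Lhat V = 1 / (n : ℝ) * ∑ i, ℓ i (A i V) := hLhat V
  have hsurj (q : Fin n → EuclideanSpace ℝ (Fin my)) : ∃ V, ∀ i, F V i = q i := by
    choose v hv using fun j => Matrix.mulVec_surjective_of_rank_eq_card
      ((hrank j).trans (Fintype.card_fin n).symm) fun i => q i j
    refine ⟨WithLp.toLp 2 fun jkl => v jkl.1 jkl.2, fun i => ?_⟩
    ext j
    rw [hFφ, ← congrFun (hv j) i, Matrix.mulVec, dotProduct]
    refine Finset.sum_congr rfl fun kl _ => ?_
    rw [hentry, mul_comm (a j kl.1)]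
  have hZle (i j) : ∑ kl : Fin mH × Fin mH1, (a j kl.1 * φ (R j) u i kl) ^ 2 ≤ Z i ^ 2 := by
    have h : √(∑ kl : Fin mH × Fin mH1, (a j kl.1 * φ (R j) u i kl) ^ 2) ≤ Z i := by
      rw [hZ]
      refine le_ciSup_of_le (Set.finite_range _).bddAbove j (le_of_eq ?_)
      simp only [← Matrix.diagonal_one, Matrix.diagonal_kronecker_diagonal,
        Matrix.mulVec_diagonal, mul_one]
    exact (Real.sqrt_le_iff.1 h).2
  have hA (i V) : ‖A i V‖ ^ 2 ≤ Z i ^ 2 * ‖V‖ ^ 2 := by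
    change ‖F V i‖ ^ 2 ≤ _
    rw [EuclideanSpace.real_norm_sq_eq, EuclideanSpace.real_norm_sq_eq, Fintype.sum_prod_type,
      Finset.mul_sum]
    refine Finset.sum_le_sum fun j _ => ?_
    rw [hFφ]
    exact (Finset.sum_mul_sq_le_sq_mul_sq _ _ _).trans
      (mul_le_mul_of_nonneg_right (hZle i j) (Finset.sum_nonneg fun _ _ => sq_nonneg _))
  have hc : 0 ≤ 1 / (n : ℝ) := by positivity
  have hsmooth := mul_sum_comp_le_add_inner_gradient hc hLℓ hℓdiff hℓlip hA hfA
  rw [mul_one_div, ← hLcdef] at hsmooth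
  intro t ht q
  have htτ : (0 : ℝ) < t - τ := sub_pos.2 (Nat.cast_lt.2 ht)
  have hrate (V) : Lhat (W t) - Lhat V ≤ Lc / (2 * ((t : ℝ) - τ)) * ‖V - W τ‖ ^ 2 := by
    have h := gradientDescent_le hLc
      (fun V => (hasFDerivAt_mul_sum_comp hℓdiff hfA V).differentiableAt)
      (convexOn_mul_sum_comp hc hℓconv hfA) hsmooth (w := fun k => W (τ + k))
      (fun k => hupd (τ + k) (Nat.le_add_right τ k)) V (t - τ)
    simp only [add_zero, Nat.add_sub_cancel' ht.le, Nat.cast_sub ht.le] at h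
    rw [norm_sub_rev (W τ) V] at h
    have hnn : 0 ≤ Lc / 2 * ‖W t - V‖ ^ 2 := by positivity
    rw [div_mul_eq_mul_div, le_div_iff₀ (by positivity)]
    linarith
  obtain ⟨V₀, hV₀⟩ := hsurj q
  have hmain : Lhat (W t) - max (1 / (n : ℝ) * ∑ i, ℓ i (q i)) εbar ≤
      Lc / (2 * ((t : ℝ) - τ)) * B ^ 2 := by
    rw [hB]
    refine le_mul_sInf_sq (hΘne.image _) ?_ (by positivity) ?_
    · rintro _ ⟨V, _, rfl⟩
      exact norm_nonneg _
    · rintro _ ⟨V, hV, rfl⟩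
      rw [hΘ] at hV
      have hVq := (le_max_left _ _).trans (hV V₀)
      simp only [hLhat V₀, hV₀] at hVq
      linarith [hrate V]
  rw [div_mul_eq_mul_div Lc] at hmain
  linarith
end
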